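/- arXiv:2410.15798 — 8 statements merged into one kernel-verified Lean document; each statement's English description precedes it below -/
import Mathlib

section
/- Let α < 0 be real and let β0 ∈ (π/2, π) satisfy α·sin β0 = β0·cos β0. Define φ(x) = −e^{αx}·sqrt(α² + β0²)·sin(β0·(x−1)). Then: (i) φ(1) = 0; (ii) φ(x) > 0 for every x ∈ (0,1); (iii) the derivative satisfies φ'(x) = −e^{αx}·(α² + β0²)·sin(β0·x) for every real x; consequently (iv) φ'(0) = 0 and (v) φ'(x) < 0 for every x ∈ (0,1). -/
/-- Properties of the principal eigenfunction `φ(x) = −e^{αx}·√(α²+β0²)·sin(β0(x−1))`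
of Lemma 3.8: `φ(1) = 0`, `φ > 0` on `(0,1)`, its derivative is
`φ'(x) = −e^{αx}·(α²+β0²)·sin(β0 x)`, so `φ'(0) = 0` and `φ' < 0` on `(0,1)`. -/
theorem stmt2 (α β0 : ℝ) (hα : α < 0) (hβ0 : β0 ∈ Set.Ioo (Real.pi / 2) Real.pi)
    (heq : α * Real.sin β0 = β0 * Real.cos β0)
    (φ : ℝ → ℝ)
    (hφ : ∀ x : ℝ,
      φ x = -Real.exp (α * x) * Real.sqrt (α ^ 2 + β0 ^ 2) * Real.sin (β0 * (x - 1))) :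
    φ 1 = 0 ∧
    (∀ x ∈ Set.Ioo (0 : ℝ) 1, 0 < φ x) ∧
    (∀ x : ℝ, deriv φ x = -Real.exp (α * x) * (α ^ 2 + β0 ^ 2) * Real.sin (β0 * x)) ∧
    deriv φ 0 = 0 ∧
    (∀ x ∈ Set.Ioo (0 : ℝ) 1, deriv φ x < 0) := by
  obtain ⟨h1, h2⟩ := hβ0
  have hpi := Real.pi_pos
  have hb : 0 < β0 := by linarith
  have hs : 0 < Real.sin β0 := Real.sin_pos_of_pos_of_lt_pi hb h2
  have hpos : 0 < α ^ 2 + β0 ^ 2 := by positivity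
  have hR : 0 < Real.sqrt (α ^ 2 + β0 ^ 2) := Real.sqrt_pos.mpr hpos
  have hR2 : Real.sqrt (α ^ 2 + β0 ^ 2) ^ 2 = α ^ 2 + β0 ^ 2 := Real.sq_sqrt hpos.le
  have hfun : φ = fun x : ℝ =>
      -Real.exp (α * x) * Real.sqrt (α ^ 2 + β0 ^ 2) * Real.sin (β0 * (x - 1)) := funext hφ
  generalize Real.sqrt (α ^ 2 + β0 ^ 2) = R at *
  have hsc := Real.sin_sq_add_cos_sq β0
  have hRs : R * Real.sin β0 = β0 := by
    have : (R * Real.sin β0) ^ 2 = β0 ^ 2 := by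
      have e : (α * Real.sin β0) ^ 2 = (β0 * Real.cos β0) ^ 2 := by rw [heq]
      rw [mul_pow, hR2]
      linear_combination e + β0 ^ 2 * hsc
    exact (pow_left_inj₀ (by positivity) hb.le two_ne_zero).mp this
  have hRc : R * Real.cos β0 = α := by
    apply mul_left_cancel₀ hb.ne'
    linear_combination (-R) * heq + α * hRs
  have hd : ∀ x : ℝ, deriv φ x = -Real.exp (α * x) * (α ^ 2 + β0 ^ 2) * Real.sin (β0 * x) := by
    intro x
    have e1 : HasDerivAt (fun x : ℝ => Real.exp (α * x)) (Real.exp (α * x) * (α * 1)) x :=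
      ((hasDerivAt_id x).const_mul α).exp
    have e2 : HasDerivAt (fun x : ℝ => Real.sin (β0 * (x - 1)))
        (Real.cos (β0 * (x - 1)) * (β0 * 1)) x :=
      (((hasDerivAt_id x).sub_const 1).const_mul β0).sin
    have e3 := (e1.neg.mul_const R).mul e2
    rw [hfun]
    refine (HasDerivAt.deriv e3).trans ?_
    have e4 : β0 * (x - 1) = β0 * x - β0 := by ring
    simp only [Pi.neg_apply, e4, Real.sin_sub, Real.cos_sub]
    linear_combination (-Real.exp (α * x)) * (Real.sin (β0 * x) * (α * hRc + β0 * hRs)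
      + R * Real.cos (β0 * x) * (-heq))
  refine ⟨by simp [hφ], ?_, hd, by simp [hd], ?_⟩
  · rintro x ⟨hx0, hx1⟩
    have : Real.sin (β0 * (x - 1)) < 0 :=
      Real.sin_neg_of_neg_of_neg_pi_lt (by nlinarith) (by nlinarith)
    rw [hφ]
    have := mul_pos (mul_pos (Real.exp_pos (α * x)) hR) (neg_pos.mpr this)
    linarith
  · rintro x ⟨hx0, hx1⟩
    have : 0 < Real.sin (β0 * x) :=
      Real.sin_pos_of_pos_of_lt_pi (by positivity) (by nlinarith)
    rw [hd]
    have := mul_pos (mul_pos (Real.exp_pos (α * x)) hpos) this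
    linarith
end

section
/- Let d1, d2, a11, a12, a22, F, λ0 be positive real numbers, and λ, k arbitrary reals. Define c1 = ( −(d1+d2)·λ0 − a11 − a22 + sqrt( (a22 + (d2−d1)·λ0 − a11)² + 4·a12·F ) )/2, c2 = ( −(d1+d2)·λ0 − a11 − a22 − sqrt( (a22 + (d2−d1)·λ0 − a11)² + 4·a12·F ) )/2, κ1 = λ + c1, κ2 = λ + c2, D = a12·F − (a11 + d1·λ0 + c1)·(a22 + d2·λ0 + c2), and functions Φ(t) = ( a12·e^{κ1·t} − (a11 + d1·λ0 + c1)·k·e^{κ2·t} )/D and Ψ(t) = ( F·k·e^{κ2·t} − (a22 + d2·λ0 + c2)·e^{κ1·t} )/D. Then for every real t, Φ'(t) = (λ − d1·λ0 − a11)·Φ(t) + a12·Ψ(t) and Ψ'(t) = F·Φ(t) + (λ − d2·λ0 − a22)·Ψ(t). -/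
/-- Formula (SFC-12) of Lemma 3.3: the explicit exponential pair `(Φ, Ψ)` solves the
separated linear system `Φ' = (λ − d1·λ0 − a11)·Φ + a12·Ψ`,
`Ψ' = F·Φ + (λ − d2·λ0 − a22)·Ψ`. -/
theorem stmt8 (d1 d2 a11 a12 a22 F l0 lam k c1 c2 κ1 κ2 D : ℝ)
    (hd1 : 0 < d1) (hd2 : 0 < d2) (ha11 : 0 < a11) (ha12 : 0 < a12) (ha22 : 0 < a22)
    (hF : 0 < F) (hl0 : 0 < l0)
    (hc1 : c1 = (-(d1 + d2) * l0 - a11 - a22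
      + Real.sqrt ((a22 + (d2 - d1) * l0 - a11) ^ 2 + 4 * a12 * F)) / 2)
    (hc2 : c2 = (-(d1 + d2) * l0 - a11 - a22
      - Real.sqrt ((a22 + (d2 - d1) * l0 - a11) ^ 2 + 4 * a12 * F)) / 2)
    (hκ1 : κ1 = lam + c1) (hκ2 : κ2 = lam + c2)
    (hD : D = a12 * F - (a11 + d1 * l0 + c1) * (a22 + d2 * l0 + c2))
    (Φ Ψ : ℝ → ℝ)
    (hΦ : ∀ t : ℝ, Φ t = (a12 * Real.exp (κ1 * t)
      - (a11 + d1 * l0 + c1) * k * Real.exp (κ2 * t)) / D)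
    (hΨ : ∀ t : ℝ, Ψ t = (F * k * Real.exp (κ2 * t)
      - (a22 + d2 * l0 + c2) * Real.exp (κ1 * t)) / D) :
    ∀ t : ℝ,
      deriv Φ t = (lam - d1 * l0 - a11) * Φ t + a12 * Ψ t ∧
      deriv Ψ t = F * Φ t + (lam - d2 * l0 - a22) * Ψ t := by
  intro t
  have hnn : 0 ≤ (a22 + (d2 - d1) * l0 - a11) ^ 2 + 4 * a12 * F := by positivity
  have hsq := Real.sq_sqrt hnn
  have hs : c1 + c2 + a11 + d1 * l0 + a22 + d2 * l0 = 0 := by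
    rw [hc1, hc2]; ring
  have hp : (a11 + d1 * l0 + c1) * (a11 + d1 * l0 + c2) + a12 * F = 0 := by
    rw [hc1, hc2]; linear_combination (-1 / 4) * hsq
  have hq : (a22 + d2 * l0 + c1) * (a22 + d2 * l0 + c2) + a12 * F = 0 := by
    rw [hc1, hc2]; linear_combination (-1 / 4) * hsq
  have he : ∀ κ : ℝ, HasDerivAt (fun s : ℝ => Real.exp (κ * s)) (Real.exp (κ * t) * κ) t := by
    intro κ
    simpa using ((hasDerivAt_id t).const_mul κ).exp
  have h1 := (((he κ1).const_mul a12).sub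
    ((he κ2).const_mul ((a11 + d1 * l0 + c1) * k))).div_const D
  have h2 := (((he κ2).const_mul (F * k)).sub
    ((he κ1).const_mul (a22 + d2 * l0 + c2))).div_const D
  have e1 := (h1.congr_of_eventuallyEq (Filter.Eventually.of_forall hΦ)).deriv
  have e2 := (h2.congr_of_eventuallyEq (Filter.Eventually.of_forall hΨ)).deriv
  rw [e1, e2, hΦ t, hΨ t]
  clear e1 e2 h1 h2 he hD
  generalize Real.exp (κ1 * t) = E1
  generalize Real.exp (κ2 * t) = E2
  subst hκ1 hκ2
  clear hc1 hc2
  constructor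
  · linear_combination (E1 * a12 / D) * hs - (k * E2 / D) * hp
  · linear_combination (E2 * F * k / D) * hs - (E1 / D) * hq
end

section
/- Let d1, d2, a11, a12, a22, F, λ0, λ0h, τ be positive real numbers with λ0 ≤ λ0h, let λ be real, and define c1 = ( −(d1+d2)·λ0 − a11 − a22 + sqrt( (a22 + (d2−d1)·λ0 − a11)² + 4·a12·F ) )/2 and c2 = ( −(d1+d2)·λ0 − a11 − a22 − sqrt( (a22 + (d2−d1)·λ0 − a11)² + 4·a12·F ) )/2, κ1 = λ + c1, κ2 = λ + c2. Assume κ1 > 0, κ2 ≤ 0, and k ≥ 0. Then for every t ∈ [0, τ], ( a12·e^{κ1·t} − (a11 + d1·λ0 + c1)·k·e^{κ2·t} ) / ( a12·F + (a11 + d1·λ0 + c1)² ) ≤ e^{(2·sqrt(a12·F) + a11 + a22 + (d1+d2)·λ0h)·τ} / F. -/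
/-- The `h`-uniform upper bound `Φ(t) ≤ α2` of Lemma 3.3: with `κ1 > 0`, `κ2 ≤ 0` and
`k ≥ 0`, for every `t ∈ [0, τ]`,
`(a12·e^{κ1 t} − (a11 + d1·λ0 + c1)·k·e^{κ2 t})/(a12·F + (a11 + d1·λ0 + c1)²)
  ≤ e^{(2√(a12·F) + a11 + a22 + (d1+d2)·λ0h)·τ}/F`. -/
theorem stmt9 (d1 d2 a11 a12 a22 F l0 l0h τ lam k c1 c2 κ1 κ2 : ℝ)
    (hd1 : 0 < d1) (hd2 : 0 < d2) (ha11 : 0 < a11) (ha12 : 0 < a12) (ha22 : 0 < a22)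
    (hF : 0 < F) (hl0 : 0 < l0) (hl0h : 0 < l0h) (hτ : 0 < τ) (hle : l0 ≤ l0h)
    (hc1 : c1 = (-(d1 + d2) * l0 - a11 - a22
      + Real.sqrt ((a22 + (d2 - d1) * l0 - a11) ^ 2 + 4 * a12 * F)) / 2)
    (hc2 : c2 = (-(d1 + d2) * l0 - a11 - a22
      - Real.sqrt ((a22 + (d2 - d1) * l0 - a11) ^ 2 + 4 * a12 * F)) / 2)
    (hκ1 : κ1 = lam + c1) (hκ2 : κ2 = lam + c2)
    (hκ1pos : 0 < κ1) (hκ2nonpos : κ2 ≤ 0) (hk : 0 ≤ k) :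
    ∀ t ∈ Set.Icc (0 : ℝ) τ,
      (a12 * Real.exp (κ1 * t) - (a11 + d1 * l0 + c1) * k * Real.exp (κ2 * t))
          / (a12 * F + (a11 + d1 * l0 + c1) ^ 2)
        ≤ Real.exp ((2 * Real.sqrt (a12 * F) + a11 + a22 + (d1 + d2) * l0h) * τ) / F := by
  intro t ht
  obtain ⟨ht0, htτ⟩ := ht
  have hP : 0 < a12 * F := mul_pos ha12 hF
  set D := a22 + (d2 - d1) * l0 - a11 with hD
  set S := Real.sqrt (D ^ 2 + 4 * a12 * F) with hS
  have hDS : |D| ≤ S := Real.abs_le_sqrt (by nlinarith)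
  have hG : 0 ≤ a11 + d1 * l0 + c1 := by
    have h1 := le_abs_self D
    rw [hc1]
    linarith
  have hq0 := Real.sqrt_nonneg (a12 * F)
  have hq := Real.sq_sqrt hP.le
  have hS2 : S ≤ |D| + 2 * Real.sqrt (a12 * F) := by
    apply Real.sqrt_le_iff.2
    have := abs_nonneg D
    refine ⟨by positivity, ?_⟩
    nlinarith [sq_abs D, mul_nonneg this hq0]
  have h1 : d1 * l0 ≤ d1 * l0h := mul_le_mul_of_nonneg_left hle hd1.le
  have h2 : d2 * l0 ≤ d2 * l0h := mul_le_mul_of_nonneg_left hle hd2.le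
  have h3 : 0 < d1 * l0 := mul_pos hd1 hl0
  have h4 : 0 < d2 * l0 := mul_pos hd2 hl0
  have hDa : |D| ≤ a11 + a22 + (d1 + d2) * l0h := by
    rw [abs_le]
    constructor <;> nlinarith
  have hκ : κ1 ≤ 2 * Real.sqrt (a12 * F) + a11 + a22 + (d1 + d2) * l0h := by
    have : κ1 - κ2 = S := by rw [hκ1, hκ2, hc1, hc2]; ring
    linarith
  have hexp : Real.exp (κ1 * t) ≤
      Real.exp ((2 * Real.sqrt (a12 * F) + a11 + a22 + (d1 + d2) * l0h) * τ) := by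
    apply Real.exp_le_exp.2
    exact mul_le_mul hκ htτ ht0 (by linarith)
  set E := Real.exp ((2 * Real.sqrt (a12 * F) + a11 + a22 + (d1 + d2) * l0h) * τ) with hE
  have hE0 : 0 < E := Real.exp_pos _
  have hn : 0 ≤ (a11 + d1 * l0 + c1) * k * Real.exp (κ2 * t) := by positivity
  calc _ ≤ (a12 * E) / (a12 * F) := by
        apply div_le_div₀ (by positivity) _ hP
        · have := sq_nonneg (a11 + d1 * l0 + c1)
          linarith
        · have := mul_le_mul_of_nonneg_left hexp ha12.le
          linarith
    _ = E / F := mul_div_mul_left _ _ ha12.ne'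
end

section
/- Let d1, d2, a11, a12, a22, F, λ0, τ be positive real numbers, let λ be real, and define c1 = ( −(d1+d2)·λ0 − a11 − a22 + sqrt( (a22 + (d2−d1)·λ0 − a11)² + 4·a12·F ) )/2 and c2 = ( −(d1+d2)·λ0 − a11 − a22 − sqrt( (a22 + (d2−d1)·λ0 − a11)² + 4·a12·F ) )/2, κ1 = λ + c1, κ2 = λ + c2. Assume κ1 > 0, κ2 ≤ 0, and 0 ≤ k ≤ a12/(a11 + d1·λ0 + c1). Then for every t ∈ [0, τ], ( F·k·e^{κ2·t} + (a11 + d1·λ0 + c1)·e^{κ1·t} ) / ( a12·F + (a11 + d1·λ0 + c1)² ) ≤ e^{(c1 − c2)·τ} / (a11 + d1·λ0 + c1). -/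
/-- The upper-bound chain for `Ψ(t)` in Lemma 3.3: with `κ1 > 0`, `κ2 ≤ 0` and
`0 ≤ k ≤ a12/(a11 + d1·λ0 + c1)`, for every `t ∈ [0, τ]`,
`(F·k·e^{κ2 t} + (a11 + d1·λ0 + c1)·e^{κ1 t})/(a12·F + (a11 + d1·λ0 + c1)²)
  ≤ e^{(c1 − c2)·τ}/(a11 + d1·λ0 + c1)`. -/
theorem stmt10 (d1 d2 a11 a12 a22 F l0 τ lam k c1 c2 κ1 κ2 : ℝ)
    (hd1 : 0 < d1) (hd2 : 0 < d2) (ha11 : 0 < a11) (ha12 : 0 < a12) (ha22 : 0 < a22)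
    (hF : 0 < F) (hl0 : 0 < l0) (hτ : 0 < τ)
    (hc1 : c1 = (-(d1 + d2) * l0 - a11 - a22
      + Real.sqrt ((a22 + (d2 - d1) * l0 - a11) ^ 2 + 4 * a12 * F)) / 2)
    (hc2 : c2 = (-(d1 + d2) * l0 - a11 - a22
      - Real.sqrt ((a22 + (d2 - d1) * l0 - a11) ^ 2 + 4 * a12 * F)) / 2)
    (hκ1 : κ1 = lam + c1) (hκ2 : κ2 = lam + c2)
    (hκ1pos : 0 < κ1) (hκ2nonpos : κ2 ≤ 0)
    (hk0 : 0 ≤ k) (hk1 : k ≤ a12 / (a11 + d1 * l0 + c1)) :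
    ∀ t ∈ Set.Icc (0 : ℝ) τ,
      (F * k * Real.exp (κ2 * t) + (a11 + d1 * l0 + c1) * Real.exp (κ1 * t))
          / (a12 * F + (a11 + d1 * l0 + c1) ^ 2)
        ≤ Real.exp ((c1 - c2) * τ) / (a11 + d1 * l0 + c1) := by
  have hm : 0 < a11 + d1 * l0 + c1 := by
    have h : |a22 + (d2 - d1) * l0 - a11|
        < Real.sqrt ((a22 + (d2 - d1) * l0 - a11) ^ 2 + 4 * a12 * F) := by
      rw [← Real.sqrt_sq_eq_abs]
      apply Real.sqrt_lt_sqrt (sq_nonneg _)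
      have := mul_pos ha12 hF
      linarith
    have h2 := le_abs_self (a22 + (d2 - d1) * l0 - a11)
    rw [hc1]
    linarith
  clear hc1 hc2
  rintro t ⟨ht0, ht1⟩
  generalize a11 + d1 * l0 + c1 = m at *
  have hkm : k * m ≤ a12 := (le_div_iff₀ hm).1 hk1
  have hle : κ1 ≤ c1 - c2 := by linarith
  have hE1 : Real.exp (κ1 * t) ≤ Real.exp ((c1 - c2) * τ) := by
    apply Real.exp_le_exp.2
    exact mul_le_mul hle ht1 ht0 (by linarith)
  have hE2 : Real.exp (κ2 * t) ≤ Real.exp ((c1 - c2) * τ) := by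
    apply Real.exp_le_exp.2
    have h1 : κ2 * t ≤ 0 := mul_nonpos_of_nonpos_of_nonneg hκ2nonpos ht0
    have h2 : 0 ≤ (c1 - c2) * τ := mul_nonneg (by linarith) hτ.le
    linarith
  have hp : 0 < Real.exp ((c1 - c2) * τ) := Real.exp_pos _
  generalize Real.exp ((c1 - c2) * τ) = E at *
  rw [div_le_div_iff₀ (by positivity) hm]
  have h1 : (F * (k * m)) * Real.exp (κ2 * t) ≤ (F * a12) * E :=
    mul_le_mul (mul_le_mul_of_nonneg_left hkm hF.le) hE2 (Real.exp_pos _).le (by positivity)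
  have h2 : m ^ 2 * Real.exp (κ1 * t) ≤ m ^ 2 * E :=
    mul_le_mul_of_nonneg_left hE1 (by positivity)
  linarith
end

section
/- Let a12, F, g0, τ, n12 be positive real numbers and let δ ≥ 2·sqrt(a12·F). Set E = e^{−δ·τ}, ε0 = min{ a12/2, a12·g0·(1 − e^{−2·sqrt(a12·F)·τ}) }, and k1 = (a12 − ε0)/n12. Then g0·a12 − g0·n12·E·k1 > 0 and (n12 + F·k1)/(n12 + F·E·k1) > (a12 − n12·k1)/(g0·a12 − g0·n12·E·k1). -/
/-- Inequality (SFC-14) of Lemma 3.3: with `E = e^{−δτ}`, `δ ≥ 2√(a12·F)`,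
`ε0 = min{a12/2, a12·g0·(1 − e^{−2√(a12·F)·τ})}` and `k1 = (a12 − ε0)/n12`, one has
`g0·a12 − g0·n12·E·k1 > 0` and
`(n12 + F·k1)/(n12 + F·E·k1) > (a12 − n12·k1)/(g0·a12 − g0·n12·E·k1)`. -/
theorem stmt11 (a12 F g0 τ n12 δ E ε0 k1 : ℝ)
    (ha12 : 0 < a12) (hF : 0 < F) (hg0 : 0 < g0) (hτ : 0 < τ) (hn12 : 0 < n12)
    (hδ : 2 * Real.sqrt (a12 * F) ≤ δ)
    (hE : E = Real.exp (-δ * τ))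
    (hε0 : ε0 = min (a12 / 2) (a12 * g0 * (1 - Real.exp (-2 * Real.sqrt (a12 * F) * τ))))
    (hk1 : k1 = (a12 - ε0) / n12) :
    0 < g0 * a12 - g0 * n12 * E * k1 ∧
    (a12 - n12 * k1) / (g0 * a12 - g0 * n12 * E * k1)
      < (n12 + F * k1) / (n12 + F * E * k1) := by
  have hs : 0 < Real.sqrt (a12 * F) := Real.sqrt_pos.mpr (mul_pos ha12 hF)
  have hE0 : 0 < E := hE ▸ Real.exp_pos _
  have hEle : E ≤ Real.exp (-2 * Real.sqrt (a12 * F) * τ) := by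
    rw [hE]
    apply Real.exp_le_exp.mpr
    nlinarith
  have hlt : Real.exp (-2 * Real.sqrt (a12 * F) * τ) < 1 := by
    apply Real.exp_lt_one_iff.mpr
    have := mul_pos hs hτ
    linarith
  generalize Real.exp (-2 * Real.sqrt (a12 * F) * τ) = E0 at *
  have hag : 0 < a12 * g0 := mul_pos ha12 hg0
  have he0 : 0 < ε0 := by
    rw [hε0]
    exact lt_min (by linarith) (mul_pos hag (by linarith))
  have he1 : ε0 ≤ a12 / 2 := hε0 ▸ min_le_left _ _
  have he2 : ε0 ≤ a12 * g0 * (1 - E0) := hε0 ▸ min_le_right _ _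
  have hnk : n12 * k1 = a12 - ε0 := by rw [hk1]; field_simp
  have hk : 0 < k1 := by rw [hk1]; exact div_pos (by linarith) hn12
  have hD : g0 * a12 - g0 * n12 * E * k1 = a12 * g0 * (1 - E) + g0 * E * ε0 := by
    linear_combination (-g0 * E) * hnk
  have h1 : a12 * g0 * (1 - E0) ≤ a12 * g0 * (1 - E) :=
    mul_le_mul_of_nonneg_left (by linarith) hag.le
  have h2 : 0 < g0 * E * ε0 := by positivity
  have hpos : 0 < g0 * a12 - g0 * n12 * E * k1 := by rw [hD]; linarith
  refine ⟨hpos, ?_⟩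
  have hFk : 0 < F * k1 := mul_pos hF hk
  calc (a12 - n12 * k1) / (g0 * a12 - g0 * n12 * E * k1) < 1 := by
        rw [div_lt_one hpos]; linarith
    _ < (n12 + F * k1) / (n12 + F * E * k1) := by
        rw [one_lt_div (by positivity)]
        nlinarith
end

section
/- Let h, σ, γ, M, μ1, μ2, α2, β2 be positive real numbers, define κ(t) = 1 + σ − (σ/2)·e^{−γ·t} and Γ(t) = h·κ(t), and let Φ, Ψ : ℝ → ℝ satisfy 0 ≤ Φ(t) ≤ α2 and 0 ≤ Ψ(t) ≤ β2 for all t ≥ 0. If h² ≥ 2·M·π·(μ1·α2 + μ2·β2)/(γ·σ·(2+σ)), then for every t ≥ 0: Γ'(t) = (h·σ·γ/2)·e^{−γ·t} > 0, and Γ'(t) − μ1·M·e^{−γ·t}·Φ(t)·π/(2·Γ(t)) − μ2·M·e^{−γ·t}·Ψ(t)·π/(2·Γ(t)) ≥ 0. -/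
/-- The Stefan-condition verification in Theorem 3.1: with `κ(t) = 1 + σ − (σ/2)e^{−γt}`,
`Γ(t) = h·κ(t)`, bounds `0 ≤ Φ ≤ α2`, `0 ≤ Ψ ≤ β2` on `[0,∞)` and
`h² ≥ 2Mπ(μ1·α2 + μ2·β2)/(γσ(2+σ))`, one has for all `t ≥ 0`:
`Γ'(t) = (hσγ/2)·e^{−γt} > 0` and
`Γ'(t) − μ1·M·e^{−γt}·Φ(t)·π/(2Γ(t)) − μ2·M·e^{−γt}·Ψ(t)·π/(2Γ(t)) ≥ 0`. -/
theorem stmt15 (h σ γ M μ1 μ2 α2 β2 : ℝ)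
    (hh : 0 < h) (hσ : 0 < σ) (hγ : 0 < γ) (hM : 0 < M)
    (hμ1 : 0 < μ1) (hμ2 : 0 < μ2) (hα2 : 0 < α2) (hβ2 : 0 < β2)
    (Φ Ψ : ℝ → ℝ)
    (hΦ : ∀ t : ℝ, 0 ≤ t → 0 ≤ Φ t ∧ Φ t ≤ α2)
    (hΨ : ∀ t : ℝ, 0 ≤ t → 0 ≤ Ψ t ∧ Ψ t ≤ β2)
    (κ Γ : ℝ → ℝ)
    (hκ : ∀ t, κ t = 1 + σ - (σ / 2) * Real.exp (-γ * t))
    (hΓ : ∀ t, Γ t = h * κ t)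
    (hh2 : 2 * M * Real.pi * (μ1 * α2 + μ2 * β2) / (γ * σ * (2 + σ)) ≤ h ^ 2) :
    ∀ t : ℝ, 0 ≤ t →
      (deriv Γ t = (h * σ * γ / 2) * Real.exp (-γ * t) ∧ 0 < deriv Γ t) ∧
      0 ≤ deriv Γ t - μ1 * M * Real.exp (-γ * t) * Φ t * Real.pi / (2 * Γ t)
            - μ2 * M * Real.exp (-γ * t) * Ψ t * Real.pi / (2 * Γ t) := by
  intro t ht
  have hd : deriv Γ t = (h * σ * γ / 2) * Real.exp (-γ * t) := by
    have hf : Γ = fun t => h * (1 + σ - (σ / 2) * Real.exp (-γ * t)) := by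
      funext s
      rw [hΓ, hκ]
    have h1 : HasDerivAt (fun t : ℝ => -γ * t) (-γ * 1) t :=
      (hasDerivAt_id t).const_mul (-γ)
    have h2 := (((h1.exp).const_mul (σ / 2)).const_sub (1 + σ)).const_mul h
    rw [hf, h2.deriv]
    ring
  have he : 0 < Real.exp (-γ * t) := Real.exp_pos _
  have he1 : Real.exp (-γ * t) ≤ 1 := by
    apply Real.exp_le_one_iff.mpr
    nlinarith
  have hG : h * (2 + σ) / 2 ≤ Γ t := by
    rw [hΓ, hκ]
    have : (2 + σ) / 2 ≤ 1 + σ - (σ / 2) * Real.exp (-γ * t) := by nlinarith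
    have := mul_le_mul_of_nonneg_left this hh.le
    linarith
  have hGpos : 0 < Γ t := lt_of_lt_of_le (by positivity) hG
  have hpi := Real.pi_pos
  rw [div_le_iff₀ (by positivity)] at hh2
  have hA : μ1 * Φ t + μ2 * Ψ t ≤ μ1 * α2 + μ2 * β2 :=
    add_le_add (mul_le_mul_of_nonneg_left (hΦ t ht).2 hμ1.le)
      (mul_le_mul_of_nonneg_left (hΨ t ht).2 hμ2.le)
  have hB := mul_le_mul_of_nonneg_left hA (show 0 ≤ M * Real.pi by positivity)
  have hC := mul_le_mul_of_nonneg_left hG (show 0 ≤ h * σ * γ by positivity)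
  have hD : 0 ≤ h * σ * γ * Γ t - M * Real.pi * (μ1 * Φ t + μ2 * Ψ t) := by
    linarith
  refine ⟨⟨hd, by rw [hd]; positivity⟩, ?_⟩
  have hE : deriv Γ t - μ1 * M * Real.exp (-γ * t) * Φ t * Real.pi / (2 * Γ t)
            - μ2 * M * Real.exp (-γ * t) * Ψ t * Real.pi / (2 * Γ t)
      = Real.exp (-γ * t) * (h * σ * γ * Γ t - M * Real.pi * (μ1 * Φ t + μ2 * Ψ t))
        / (2 * Γ t) := by
    rw [hd]
    field_simp
    ring
  rw [hE]
  exact div_nonneg (mul_nonneg he.le hD) (by positivity)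
end

section
/- Let d1, a11, a12, h, σ, γ, M be positive real numbers and λ a real number. Define κ(t) = 1 + σ − (σ/2)·e^{−γ·t} and Γ(t) = h·κ(t). Let Φ, Ψ : ℝ → ℝ be such that Φ is differentiable, Φ(t) > 0, Ψ(t) ≥ 0, and Φ'(t) = (λ − d1·π²/(4·h²) − a11)·Φ(t) + a12·Ψ(t) for all t. Assume λ − γ − d1·(π²/(4·h²))·(1 − κ(t)^{−2}) ≥ 0 for all t ≥ 0. Define ū(t,x) = M·e^{−γ·t}·Φ(t)·cos(π·x/(2·Γ(t))) and v̄(t,x) = M·e^{−γ·t}·Ψ(t)·cos(π·x/(2·Γ(t))). Then for every t ≥ 0 and every x with |x| ≤ Γ(t): ∂tū(t,x) − d1·∂xxū(t,x) + a11·ū(t,x) − a12·v̄(t,x) ≥ 0. -/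
/-- The interior supersolution inequality (3-5) of Theorem 3.1: with
`ū(t,x) = M·e^{−γt}·Φ(t)·cos(πx/(2Γ(t)))`, `v̄(t,x) = M·e^{−γt}·Ψ(t)·cos(πx/(2Γ(t)))`,
where `Φ' = (λ − d1·π²/(4h²) − a11)·Φ + a12·Ψ`, `Φ > 0`, `Ψ ≥ 0`, and
`λ − γ − d1·(π²/(4h²))·(1 − κ(t)⁻²) ≥ 0` for `t ≥ 0`, one has
`∂ₜū − d1·∂ₓₓū + a11·ū − a12·v̄ ≥ 0` for all `t ≥ 0` and `|x| ≤ Γ(t)`. -/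
theorem stmt16 (d1 a11 a12 h σ γ M lam : ℝ)
    (hd1 : 0 < d1) (ha11 : 0 < a11) (ha12 : 0 < a12) (hh : 0 < h)
    (hσ : 0 < σ) (hγ : 0 < γ) (hM : 0 < M)
    (κ Γ : ℝ → ℝ)
    (hκ : ∀ t, κ t = 1 + σ - (σ / 2) * Real.exp (-γ * t))
    (hΓ : ∀ t, Γ t = h * κ t)
    (Φ Ψ : ℝ → ℝ)
    (hΦpos : ∀ t, 0 < Φ t) (hΨnonneg : ∀ t, 0 ≤ Ψ t)
    (hΦ' : ∀ t, HasDerivAt Φ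
      ((lam - d1 * Real.pi ^ 2 / (4 * h ^ 2) - a11) * Φ t + a12 * Ψ t) t)
    (hlam : ∀ t : ℝ, 0 ≤ t →
      0 ≤ lam - γ - d1 * (Real.pi ^ 2 / (4 * h ^ 2)) * (1 - 1 / (κ t) ^ 2))
    (ubar vbar : ℝ → ℝ → ℝ)
    (hubar : ∀ t x, ubar t x
      = M * Real.exp (-γ * t) * Φ t * Real.cos (Real.pi * x / (2 * Γ t)))
    (hvbar : ∀ t x, vbar t x
      = M * Real.exp (-γ * t) * Ψ t * Real.cos (Real.pi * x / (2 * Γ t))) :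
    ∀ t : ℝ, 0 ≤ t → ∀ x : ℝ, |x| ≤ Γ t →
      0 ≤ deriv (fun s => ubar s x) t - d1 * deriv (deriv (fun y => ubar t y)) x
            + a11 * ubar t x - a12 * vbar t x := by
  intro t ht x hx
  have hE : 0 < Real.exp (-γ * t) := Real.exp_pos _
  have hE1 : Real.exp (-γ * t) ≤ 1 := Real.exp_le_one_iff.mpr (by nlinarith)
  have hk : 0 < κ t := by rw [hκ]; nlinarith
  have hG : 0 < Γ t := by rw [hΓ]; positivity
  have hdE : HasDerivAt (fun s => Real.exp (-γ * s)) (Real.exp (-γ * t) * (-γ)) t := by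
    have := ((hasDerivAt_id t).const_mul (-γ)).exp
    simpa using this
  have hdG : HasDerivAt Γ (h * (σ / 2 * γ * Real.exp (-γ * t))) t := by
    have e : Γ = fun s => h * (1 + σ - (σ / 2) * Real.exp (-γ * s)) := by
      funext s; rw [hΓ, hκ]
    rw [e]
    have := ((hdE.const_mul (σ / 2)).const_sub (1 + σ)).const_mul h
    exact this.congr_deriv (by ring)
  have hG2 : 2 * Γ t ≠ 0 := by positivity
  have hdθ := (hasDerivAt_const t (Real.pi * x)).fun_div (hdG.const_mul 2) hG2
  have hdt := (((hdE.const_mul M).fun_mul (hΦ' t)).fun_mul hdθ.cos)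
  have e1 : (fun s => ubar s x) = fun s => M * Real.exp (-γ * s) * Φ s *
      Real.cos (Real.pi * x / (2 * Γ s)) := by
    funext s; rw [hubar]
  have hlin : ∀ y : ℝ, HasDerivAt (fun y => Real.pi * y / (2 * Γ t)) (Real.pi / (2 * Γ t)) y := by
    intro y
    simpa using ((hasDerivAt_id y).const_mul Real.pi).div_const (2 * Γ t)
  have e2 : deriv (fun y => ubar t y) = fun y => M * Real.exp (-γ * t) * Φ t *
      (-Real.sin (Real.pi * y / (2 * Γ t)) * (Real.pi / (2 * Γ t))) := by
    funext y
    have e3 : (fun y => ubar t y) = fun y => M * Real.exp (-γ * t) * Φ t *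
      Real.cos (Real.pi * y / (2 * Γ t)) := by
      funext s; rw [hubar]
    rw [e3]
    exact ((hlin y).cos.const_mul _).deriv
  have e4 := (((hlin x).sin.fun_neg.mul_const (Real.pi / (2 * Γ t))).const_mul
    (M * Real.exp (-γ * t) * Φ t)).deriv
  rw [e1, hdt.deriv, e2, e4, hubar, hvbar]
  have hx' := abs_le.mp hx
  have hpi := Real.pi_pos
  have hθ1 : Real.pi * x / (2 * Γ t) ≤ Real.pi / 2 := by
    rw [div_le_iff₀ (by positivity)]; nlinarith [hx'.2]
  have hθ2 : -(Real.pi / 2) ≤ Real.pi * x / (2 * Γ t) := by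
    rw [le_div_iff₀ (by positivity)]; nlinarith [hx'.1]
  have hc := Real.cos_nonneg_of_neg_pi_div_two_le_of_le hθ2 hθ1
  have hs : 0 ≤ x * Real.sin (Real.pi * x / (2 * Γ t)) := by
    rcases le_total 0 x with h0 | h0
    · exact mul_nonneg h0 (Real.sin_nonneg_of_nonneg_of_le_pi (by positivity) (by linarith))
    · refine mul_nonneg_of_nonpos_of_nonpos h0
        (Real.sin_nonpos_of_nonpos_of_neg_pi_le ?_ (by linarith))
      exact div_nonpos_of_nonpos_of_nonneg (by nlinarith) (by positivity)
  have hP := hΦpos t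
  have hl := hlam t ht
  generalize Real.cos (Real.pi * x / (2 * Γ t)) = C at *
  generalize Real.sin (Real.pi * x / (2 * Γ t)) = S at *
  have key : 0 ≤ M * Real.exp (-γ * t) * Φ t * C *
        (lam - γ - d1 * (Real.pi ^ 2 / (4 * h ^ 2)) * (1 - 1 / (κ t) ^ 2))
      + M * Real.exp (-γ * t) * Φ t * (x * S) *
        (Real.pi * (2 * (h * (σ / 2 * γ * Real.exp (-γ * t)))) / (2 * Γ t) ^ 2) := by
    positivity
  refine key.trans_eq ?_
  rw [hΓ t]
  generalize Real.exp (-γ * t) = E at *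
  field_simp
  ring
end

section
/- Let a11, a12, a22, τ be positive real numbers. Let f : ℝ → ℝ be continuously differentiable with f(0) = 0, f'(u) > 0 for all u ≥ 0, and u ↦ f(u)/u strictly decreasing on (0, ∞). Let G : ℝ → ℝ be continuous with G(u) > 0 for u > 0 and u ↦ G(u)/u strictly decreasing on (0, ∞). Suppose (U1, V1) and (U2, V2) are two pairs of functions on (0, τ], each differentiable on (0, τ] and satisfying Ui'(t) = a12·Vi(t) − a11·Ui(t) and Vi'(t) = f(Ui(t)) − a22·Vi(t) for all t ∈ (0, τ], with Ui(t) > 0 and Vi(t) > 0 on (0, τ], and whose right limits at 0 exist and satisfy lim_{t→0⁺} Ui(t) = G(Ui(τ)) and lim_{t→0⁺} Vi(t) = Vi(τ). Then U1 = U2 and V1 = V2 on (0, τ]. -/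
/-- The function `x ↦ (min x 0)^2` is differentiable. -/
theorem hasDerivAt_minsq (x : ℝ) :
    HasDerivAt (fun y : ℝ => (min y 0) ^ 2) (2 * min x 0) x := by
  rcases lt_trichotomy x 0 with h | h | h
  · have h1 : HasDerivAt (fun y : ℝ => y ^ 2) (2 * min x 0) x := by
      rw [min_eq_left h.le]
      simpa using hasDerivAt_pow 2 x
    refine h1.congr_of_eventuallyEq ?_
    filter_upwards [Iio_mem_nhds h] with y hy
    rw [min_eq_left (le_of_lt hy)]
  · subst h
    have h1 : HasDerivAt (fun y : ℝ => y ^ 2) 0 (0 : ℝ) := by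
      simpa using hasDerivAt_pow 2 (0 : ℝ)
    rw [hasDerivAt_iff_isLittleO] at h1 ⊢
    refine Asymptotics.IsBigO.trans_isLittleO ?_ h1
    refine Asymptotics.IsBigO.of_bound 1 (Filter.Eventually.of_forall fun y => ?_)
    rcases le_total y 0 with hy | hy
    · simp [min_eq_left hy]
    · simp [min_eq_right hy]
      positivity
  · have h1 : HasDerivAt (fun _ : ℝ => (0 : ℝ)) (2 * min x 0) x := by
      rw [min_eq_right h.le]
      simpa using hasDerivAt_const x (0 : ℝ)
    refine h1.congr_of_eventuallyEq ?_
    filter_upwards [Ioi_mem_nhds h] with y hy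
    rw [min_eq_right (le_of_lt hy)]
    simp

/-- A positive solution of the system, continuous up to `0`. -/
structure PosSol (a11 a12 a22 τ : ℝ) (f u v : ℝ → ℝ) : Prop where
  cu : ContinuousOn u (Set.Icc 0 τ)
  cv : ContinuousOn v (Set.Icc 0 τ)
  du : ∀ t ∈ Set.Ioo 0 τ, HasDerivAt u (a12 * v t - a11 * u t) t
  dv : ∀ t ∈ Set.Ioo 0 τ, HasDerivAt v (f (u t) - a22 * v t) t
  pu : ∀ t ∈ Set.Icc 0 τ, 0 < u t
  pv : ∀ t ∈ Set.Icc 0 τ, 0 < v t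

theorem one_sided (f : ℝ → ℝ) (hf : ContDiff ℝ 1 f)
    (hm : MonotoneOn f (Set.Ici 0)) (M : ℝ) :
    ∃ L : ℝ, 0 ≤ L ∧ ∀ x ∈ Set.Icc 0 M, ∀ y ∈ Set.Icc 0 M, L * min (x - y) 0 ≤ f x - f y := by
  obtain ⟨K, hK⟩ := hf.contDiffOn.exists_lipschitzOnWith (s := Set.Icc (0 : ℝ) M)
    (by norm_num) (convex_Icc 0 M) isCompact_Icc
  refine ⟨K, K.2, fun x hx y hy => ?_⟩
  rcases le_total y x with h | h
  · rw [min_eq_right (by linarith)]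
    have := hm (Set.mem_Ici.2 hy.1) (Set.mem_Ici.2 hx.1) h
    simp; linarith
  · rw [min_eq_left (by linarith)]
    have := hK.dist_le_mul y hy x hx
    rw [Real.dist_eq, Real.dist_eq, abs_of_nonneg (sub_nonneg.2 h)] at this
    have := le_abs_self (f y - f x)
    linarith

theorem sub_hom (f : ℝ → ℝ) (hfq : StrictAntiOn (fun u => f u / u) (Set.Ioi (0 : ℝ)))
    (m x : ℝ) (hm : 1 < m) (hx : 0 < x) : f (m * x) < m * f x := by
  have hmx : x < m * x := by nlinarith
  have h := hfq (Set.mem_Ioi.2 hx) (Set.mem_Ioi.2 (hx.trans hmx)) hmx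
  simp only at h
  rw [div_lt_div_iff₀ (hx.trans hmx) hx] at h
  nlinarith

theorem sub_hom_le (f : ℝ → ℝ) (hfq : StrictAntiOn (fun u => f u / u) (Set.Ioi (0 : ℝ)))
    (m x : ℝ) (hm : 1 ≤ m) (hx : 0 < x) : f (m * x) ≤ m * f x := by
  rcases hm.eq_or_lt with h | h
  · subst h; simp
  · exact (sub_hom f hfq m x h hx).le

theorem comparison {a11 a12 a22 τ : ℝ}
    (ha11 : 0 < a11) (ha12 : 0 < a12) (ha22 : 0 < a22) (hτ : 0 < τ)
    {f : ℝ → ℝ} (hf : ContDiff ℝ 1 f) (hm : MonotoneOn f (Set.Ici 0))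
    (hfq : StrictAntiOn (fun u => f u / u) (Set.Ioi (0 : ℝ)))
    {u1 v1 u2 v2 : ℝ → ℝ} (h1 : PosSol a11 a12 a22 τ f u1 v1)
    (h2 : PosSol a11 a12 a22 τ f u2 v2) {m : ℝ} (hm1 : 1 ≤ m)
    (hu0 : u1 0 ≤ m * u2 0) (hv0 : v1 0 ≤ m * v2 0) :
    ∀ t ∈ Set.Icc 0 τ, u1 t ≤ m * u2 t ∧ v1 t ≤ m * v2 t := by
  obtain ⟨M1, hM1⟩ := isCompact_Icc.bddAbove_image h1.cu
  obtain ⟨M2, hM2⟩ := isCompact_Icc.bddAbove_image h2.cu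
  have hM1' : ∀ t ∈ Set.Icc 0 τ, u1 t ≤ M1 := fun t ht => hM1 (Set.mem_image_of_mem _ ht)
  have hM2' : ∀ t ∈ Set.Icc 0 τ, u2 t ≤ M2 := fun t ht => hM2 (Set.mem_image_of_mem _ ht)
  obtain ⟨L, hL0, hL⟩ := one_sided f hf hm (max M1 (m * M2))
  set p : ℝ → ℝ := fun t => m * u2 t - u1 t with hp
  set q : ℝ → ℝ := fun t => m * v2 t - v1 t with hq
  have cp : ContinuousOn p (Set.Icc 0 τ) := (continuousOn_const.mul h2.cu).sub h1.cu
  have cq : ContinuousOn q (Set.Icc 0 τ) := (continuousOn_const.mul h2.cv).sub h1.cv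
  set K := a12 + L with hK
  set W : ℝ → ℝ := fun t => ((min (p t) 0) ^ 2 + (min (q t) 0) ^ 2) * Real.exp (-(K * t)) with hW
  have cW : ContinuousOn W (Set.Icc 0 τ) := by
    refine ContinuousOn.mul ?_ (by fun_prop)
    exact ((cp.inf continuousOn_const).pow 2).add ((cq.inf continuousOn_const).pow 2)
  have dW : ∀ t ∈ Set.Ioo 0 τ, ∃ d ≤ 0, HasDerivAt W d t := by
    intro t ht
    have htc := Set.Ioo_subset_Icc_self ht
    have dp : HasDerivAt p (m * (a12 * v2 t - a11 * u2 t) - (a12 * v1 t - a11 * u1 t)) t :=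
      ((h2.du t ht).const_mul m).sub (h1.du t ht)
    have dq : HasDerivAt q (m * (f (u2 t) - a22 * v2 t) - (f (u1 t) - a22 * v1 t)) t :=
      ((h2.dv t ht).const_mul m).sub (h1.dv t ht)
    have de : HasDerivAt (fun t => Real.exp (-(K * t))) (Real.exp (-(K * t)) * (-K)) t := by
      have : HasDerivAt (fun t => -(K * t)) (-K) t := by
        have h := (hasDerivAt_id t).const_mul (-K)
        simpa using h
      exact this.exp
    have d1 := (hasDerivAt_minsq (p t)).comp t dp
    have d2 := (hasDerivAt_minsq (q t)).comp t dq
    refine ⟨_, ?_, (d1.add d2).mul de⟩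
    have e0 := Real.exp_pos (-(K * t))
    have hfs := sub_hom_le f hfq m (u2 t) hm1 (h2.pu t htc)
    have hLt := hL (m * u2 t) ⟨by nlinarith [h2.pu t htc], le_max_of_le_right
      (mul_le_mul_of_nonneg_left (hM2' t htc) (by linarith))⟩ (u1 t)
      ⟨(h1.pu t htc).le, le_max_of_le_left (hM1' t htc)⟩
    have hpt : m * u2 t - u1 t = p t := rfl
    have hqt : m * v2 t - v1 t = q t := rfl
    rw [hpt] at hLt
    have i1 : m * (a12 * v2 t - a11 * u2 t) - (a12 * v1 t - a11 * u1 t)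
        = a12 * q t - a11 * p t := by rw [← hpt, ← hqt]; ring
    have i2 : L * min (p t) 0 - a22 * q t ≤
        m * (f (u2 t) - a22 * v2 t) - (f (u1 t) - a22 * v1 t) := by rw [← hqt]; nlinarith
    simp only [Function.comp, Pi.add_apply]
    rw [i1]
    generalize m * (f (u2 t) - a22 * v2 t) - (f (u1 t) - a22 * v1 t) = r at *
    have p0 : min (p t) 0 ≤ 0 := min_le_right _ _
    have q0 : min (q t) 0 ≤ 0 := min_le_right _ _
    have pp : min (p t) 0 * p t = min (p t) 0 ^ 2 := by
      rcases le_total (p t) 0 with h | h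
      · rw [min_eq_left h]; ring
      · rw [min_eq_right h]; ring
    have qq : min (q t) 0 * q t = min (q t) 0 ^ 2 := by
      rcases le_total (q t) 0 with h | h
      · rw [min_eq_left h]; ring
      · rw [min_eq_right h]; ring
    have pq : min (p t) 0 * q t ≤ min (p t) 0 * min (q t) 0 :=
      mul_le_mul_of_nonpos_left (min_le_left _ _) p0
    have qr : min (q t) 0 * r ≤ min (q t) 0 * (L * min (p t) 0 - a22 * q t) :=
      mul_le_mul_of_nonpos_left i2 q0
    generalize min (p t) 0 = P at *
    generalize min (q t) 0 = Q at *
    have j1 : P * (a12 * q t - a11 * p t) ≤ a12 * (P * Q) := by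
      have : P * (a12 * q t - a11 * p t) = a12 * (P * q t) - a11 * P ^ 2 := by rw [← pp]; ring
      nlinarith [sq_nonneg P]
    have j2 : Q * r ≤ L * (P * Q) := by
      have : Q * (L * P - a22 * q t) = L * (P * Q) - a22 * Q ^ 2 := by rw [← qq]; ring
      nlinarith [sq_nonneg Q]
    have j3 : 2 * (K * (P * Q)) ≤ K * (P ^ 2 + Q ^ 2) := by
      have : 0 ≤ K := by positivity
      nlinarith [mul_nonneg this (sq_nonneg (P - Q))]
    have j4 : 2 * P * (a12 * q t - a11 * p t) + 2 * Q * r - K * (P ^ 2 + Q ^ 2) ≤ 0 := by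
      rw [hK] at j3 ⊢
      linarith
    nlinarith [mul_nonpos_of_nonneg_of_nonpos e0.le j4]
  have aW : AntitoneOn W (Set.Icc 0 τ) := by
    apply antitoneOn_of_deriv_nonpos (convex_Icc 0 τ) cW
    · rw [interior_Icc]
      intro t ht
      obtain ⟨d, _, hd⟩ := dW t ht
      exact hd.differentiableAt.differentiableWithinAt
    · rw [interior_Icc]
      intro t ht
      obtain ⟨d, hd0, hd⟩ := dW t ht
      rw [hd.deriv]; exact hd0
  intro t ht
  have hWt := aW (Set.left_mem_Icc.2 hτ.le) ht ht.1
  have hW0 : W 0 = 0 := by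
    have e1 : min (p 0) 0 = 0 := min_eq_right (sub_nonneg.2 hu0)
    have e2 : min (q 0) 0 = 0 := min_eq_right (sub_nonneg.2 hv0)
    simp only [hW, e1, e2]; simp
  rw [hW0] at hWt
  have hs : (min (p t) 0) ^ 2 + (min (q t) 0) ^ 2 ≤ 0 :=
    nonpos_of_mul_nonpos_left hWt (Real.exp_pos _)
  have e1 : min (p t) 0 = 0 := by
    apply pow_eq_zero_iff (two_ne_zero) |>.1
    nlinarith [sq_nonneg (min (p t) 0), sq_nonneg (min (q t) 0)]
  have e2 : min (q t) 0 = 0 := by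
    apply pow_eq_zero_iff (two_ne_zero) |>.1
    nlinarith [sq_nonneg (min (p t) 0), sq_nonneg (min (q t) 0)]
  exact ⟨sub_nonneg.1 (min_eq_right_iff.1 e1), sub_nonneg.1 (min_eq_right_iff.1 e2)⟩

theorem comparison_periodic {a11 a12 a22 τ : ℝ}
    (ha11 : 0 < a11) (ha12 : 0 < a12) (ha22 : 0 < a22) (hτ : 0 < τ)
    {f : ℝ → ℝ} (hf : ContDiff ℝ 1 f) (hm : MonotoneOn f (Set.Ici 0))
    (hfq : StrictAntiOn (fun u => f u / u) (Set.Ioi (0 : ℝ)))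
    {u1 v1 u2 v2 : ℝ → ℝ} (h1 : PosSol a11 a12 a22 τ f u1 v1)
    (h2 : PosSol a11 a12 a22 τ f u2 v2) (hp1 : v1 0 = v1 τ) (hp2 : v2 0 = v2 τ)
    {l : ℝ} (hl : 1 ≤ l) (hu0 : u1 0 ≤ l * u2 0) :
    ∀ t ∈ Set.Icc 0 τ, u1 t ≤ l * u2 t ∧ v1 t ≤ l * v2 t := by
  have h0 : (0 : ℝ) ∈ Set.Icc 0 τ := Set.left_mem_Icc.2 hτ.le
  refine comparison ha11 ha12 ha22 hτ hf hm hfq h1 h2 hl hu0 ?_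
  by_contra hlt
  push Not at hlt
  obtain ⟨m, hmdef⟩ : ∃ m, m = v1 0 / v2 0 := ⟨_, rfl⟩
  have hv20 := h2.pv 0 h0
  have hlm : l < m := by rw [hmdef, lt_div_iff₀ hv20]; exact hlt
  have hmv : v1 0 = m * v2 0 := by rw [hmdef]; field_simp
  have hu0' : u1 0 ≤ m * u2 0 :=
    hu0.trans (mul_le_mul_of_nonneg_right hlm.le (h2.pu 0 h0).le)
  have hc := comparison ha11 ha12 ha22 hτ hf hm hfq h1 h2 (hl.trans hlm.le) hu0' hmv.le
  have hs : StrictMonoOn (fun t => (m * v2 t - v1 t) * Real.exp (a22 * t)) (Set.Icc 0 τ) := by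
    apply strictMonoOn_of_deriv_pos (convex_Icc 0 τ)
    · exact ((continuousOn_const.mul h2.cv).sub h1.cv).mul (by fun_prop)
    · rw [interior_Icc]
      intro t ht
      have htc := Set.Ioo_subset_Icc_self ht
      have dq := ((h2.dv t ht).const_mul m).sub (h1.dv t ht)
      have de : HasDerivAt (fun t => Real.exp (a22 * t)) (Real.exp (a22 * t) * a22) t := by
        have : HasDerivAt (fun t => a22 * t) a22 t := by
          simpa using (hasDerivAt_id t).const_mul a22
        exact this.exp
      have dd : HasDerivAt (fun t => (m * v2 t - v1 t) * Real.exp (a22 * t)) _ t := dq.mul de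
      rw [dd.deriv]
      have i1 := sub_hom f hfq m (u2 t) (hl.trans_lt hlm) (h2.pu t htc)
      have i2 := hm (Set.mem_Ici.2 (h1.pu t htc).le)
        (Set.mem_Ici.2 ((h1.pu t htc).le.trans (hc t htc).1)) (hc t htc).1
      have i3 : 0 < (m * f (u2 t) - f (u1 t)) * Real.exp (a22 * t) :=
        mul_pos (by linarith) (Real.exp_pos _)
      simp only [Pi.sub_apply]
      nlinarith
  have := hs h0 (Set.right_mem_Icc.2 hτ.le) hτ
  simp only [← hp1, ← hp2, hmv] at this
  simp at this

theorem uniq_aux {a11 a12 a22 τ : ℝ}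
    (ha11 : 0 < a11) (ha12 : 0 < a12) (ha22 : 0 < a22) (hτ : 0 < τ)
    {f : ℝ → ℝ} (hf : ContDiff ℝ 1 f) (hm : MonotoneOn f (Set.Ici 0))
    (hfq : StrictAntiOn (fun u => f u / u) (Set.Ioi (0 : ℝ)))
    {G : ℝ → ℝ} (hGq : StrictAntiOn (fun u => G u / u) (Set.Ioi (0 : ℝ)))
    {u1 v1 u2 v2 : ℝ → ℝ} (h1 : PosSol a11 a12 a22 τ f u1 v1)
    (h2 : PosSol a11 a12 a22 τ f u2 v2) (hp1 : v1 0 = v1 τ) (hp2 : v2 0 = v2 τ)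
    (hg1 : u1 0 = G (u1 τ)) (hg2 : u2 0 = G (u2 τ)) (hle : u1 0 ≤ u2 0) :
    ∀ t ∈ Set.Icc 0 τ, u1 t = u2 t ∧ v1 t = v2 t := by
  have h0 : (0 : ℝ) ∈ Set.Icc 0 τ := Set.left_mem_Icc.2 hτ.le
  have h0' : τ ∈ Set.Icc 0 τ := Set.right_mem_Icc.2 hτ.le
  have c1 := comparison_periodic ha11 ha12 ha22 hτ hf hm hfq h1 h2 hp1 hp2 le_rfl
    (by linarith : u1 0 ≤ 1 * u2 0)
  have hge : u2 0 ≤ u1 0 := by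
    have p1 := h1.pu 0 h0
    have c2 := (comparison_periodic ha11 ha12 ha22 hτ hf hm hfq h2 h1 hp2 hp1
      (l := u2 0 / u1 0) ((one_le_div p1).2 hle) (by field_simp; rfl) τ h0').1
    have c3 := (c1 τ h0').1
    rw [one_mul] at c3
    rcases c3.eq_or_lt with h | h
    · rw [hg1, hg2, h]
    · exfalso
      have h3 := hGq (Set.mem_Ioi.2 (h1.pu τ h0')) (Set.mem_Ioi.2 (h2.pu τ h0')) h
      simp only [← hg1, ← hg2] at h3
      rw [div_lt_div_iff₀ (h2.pu τ h0') (h1.pu τ h0')] at h3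
      rw [div_mul_eq_mul_div, le_div_iff₀ p1] at c2
      linarith
  have c2 := comparison_periodic ha11 ha12 ha22 hτ hf hm hfq h2 h1 hp2 hp1 le_rfl
    (by linarith : u2 0 ≤ 1 * u1 0)
  intro t ht
  have := c1 t ht
  have := c2 t ht
  constructor <;> linarith

theorem continuousOn_upd {τ : ℝ} (hτ : 0 < τ) {U : ℝ → ℝ} {l : ℝ}
    (hc : ContinuousOn U (Set.Ioc 0 τ))
    (hl : Filter.Tendsto U (nhdsWithin 0 (Set.Ioi (0 : ℝ))) (nhds l)) :
    ContinuousOn (Function.update U 0 l) (Set.Icc 0 τ) := by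
  rw [continuousOn_update_iff]
  rw [Set.Icc_sdiff_left]
  exact ⟨hc, fun _ => hl.mono_left (nhdsWithin_mono _ fun x hx => hx.1)⟩

theorem posSol_upd {a11 a12 a22 τ : ℝ} (hτ : 0 < τ) {f U V : ℝ → ℝ} {l : ℝ} (hlpos : 0 < l)
    (hU : ∀ t ∈ Set.Ioc (0 : ℝ) τ,
      HasDerivWithinAt U (a12 * V t - a11 * U t) (Set.Ioc (0 : ℝ) τ) t)
    (hV : ∀ t ∈ Set.Ioc (0 : ℝ) τ,
      HasDerivWithinAt V (f (U t) - a22 * V t) (Set.Ioc (0 : ℝ) τ) t)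
    (hUpos : ∀ t ∈ Set.Ioc (0 : ℝ) τ, 0 < U t)
    (hVpos : ∀ t ∈ Set.Ioc (0 : ℝ) τ, 0 < V t)
    (hUlim : Filter.Tendsto U (nhdsWithin 0 (Set.Ioi (0 : ℝ))) (nhds l))
    (hVlim : Filter.Tendsto V (nhdsWithin 0 (Set.Ioi (0 : ℝ))) (nhds (V τ))) :
    PosSol a11 a12 a22 τ f (Function.update U 0 l) (Function.update V 0 (V τ)) := by
  have key : ∀ (W : ℝ → ℝ) (c d t : ℝ), t ∈ Set.Ioo 0 τ →
      HasDerivWithinAt W d (Set.Ioc (0 : ℝ) τ) t → HasDerivAt (Function.update W 0 c) d t := by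
    intro W c d t ht h
    have h' := h.hasDerivAt (Ioc_mem_nhds ht.1 ht.2)
    refine h'.congr_of_eventuallyEq ?_
    filter_upwards [Ioi_mem_nhds ht.1] with y hy
    exact Function.update_of_ne (ne_of_gt hy) _ _
  refine ⟨continuousOn_upd hτ (fun t ht => (hU t ht).continuousWithinAt) hUlim,
    continuousOn_upd hτ (fun t ht => (hV t ht).continuousWithinAt) hVlim, ?_, ?_, ?_, ?_⟩
  · intro t ht
    rw [Function.update_of_ne ht.1.ne', Function.update_of_ne ht.1.ne']
    exact key _ _ _ _ ht (hU t (Set.Ioo_subset_Ioc_self ht))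
  · intro t ht
    rw [Function.update_of_ne ht.1.ne', Function.update_of_ne ht.1.ne']
    exact key _ _ _ _ ht (hV t (Set.Ioo_subset_Ioc_self ht))
  · intro t ht
    rcases ht.1.eq_or_lt with h | h
    · rw [← h, Function.update_self]; exact hlpos
    · rw [Function.update_of_ne h.ne']; exact hUpos t ⟨h, ht.2⟩
  · intro t ht
    rcases ht.1.eq_or_lt with h | h
    · rw [← h, Function.update_self]; exact hVpos τ ⟨hτ, le_rfl⟩
    · rw [Function.update_of_ne h.ne']; exact hVpos t ⟨h, ht.2⟩

/-- Uniqueness of the positive periodic solution of the spatially homogeneous impulsive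
system (3-24) in Theorem 3.3: two positive solutions of `U' = a12·V − a11·U`,
`V' = f(U) − a22·V` on `(0, τ]` whose right limits at `0` satisfy the impulsive/periodic
conditions `U(0⁺) = G(U(τ))`, `V(0⁺) = V(τ)` must coincide on `(0, τ]`. -/
theorem stmt18 (a11 a12 a22 τ : ℝ)
    (ha11 : 0 < a11) (ha12 : 0 < a12) (ha22 : 0 < a22) (hτ : 0 < τ)
    (f : ℝ → ℝ) (hf : ContDiff ℝ 1 f) (hf0 : f 0 = 0)
    (hf' : ∀ u : ℝ, 0 ≤ u → 0 < deriv f u)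
    (hfq : StrictAntiOn (fun u => f u / u) (Set.Ioi (0 : ℝ)))
    (G : ℝ → ℝ) (hGc : Continuous G) (hGpos : ∀ u : ℝ, 0 < u → 0 < G u)
    (hGq : StrictAntiOn (fun u => G u / u) (Set.Ioi (0 : ℝ)))
    (U1 V1 U2 V2 : ℝ → ℝ)
    (hU1 : ∀ t ∈ Set.Ioc (0 : ℝ) τ,
      HasDerivWithinAt U1 (a12 * V1 t - a11 * U1 t) (Set.Ioc (0 : ℝ) τ) t)
    (hV1 : ∀ t ∈ Set.Ioc (0 : ℝ) τ,
      HasDerivWithinAt V1 (f (U1 t) - a22 * V1 t) (Set.Ioc (0 : ℝ) τ) t)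
    (hU2 : ∀ t ∈ Set.Ioc (0 : ℝ) τ,
      HasDerivWithinAt U2 (a12 * V2 t - a11 * U2 t) (Set.Ioc (0 : ℝ) τ) t)
    (hV2 : ∀ t ∈ Set.Ioc (0 : ℝ) τ,
      HasDerivWithinAt V2 (f (U2 t) - a22 * V2 t) (Set.Ioc (0 : ℝ) τ) t)
    (hU1pos : ∀ t ∈ Set.Ioc (0 : ℝ) τ, 0 < U1 t)
    (hV1pos : ∀ t ∈ Set.Ioc (0 : ℝ) τ, 0 < V1 t)
    (hU2pos : ∀ t ∈ Set.Ioc (0 : ℝ) τ, 0 < U2 t)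
    (hV2pos : ∀ t ∈ Set.Ioc (0 : ℝ) τ, 0 < V2 t)
    (hU1lim : Filter.Tendsto U1 (nhdsWithin 0 (Set.Ioi (0 : ℝ))) (nhds (G (U1 τ))))
    (hV1lim : Filter.Tendsto V1 (nhdsWithin 0 (Set.Ioi (0 : ℝ))) (nhds (V1 τ)))
    (hU2lim : Filter.Tendsto U2 (nhdsWithin 0 (Set.Ioi (0 : ℝ))) (nhds (G (U2 τ))))
    (hV2lim : Filter.Tendsto V2 (nhdsWithin 0 (Set.Ioi (0 : ℝ))) (nhds (V2 τ))) :
    Set.EqOn U1 U2 (Set.Ioc (0 : ℝ) τ) ∧ Set.EqOn V1 V2 (Set.Ioc (0 : ℝ) τ) := by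
  have hm : MonotoneOn f (Set.Ici 0) := by
    refine (strictMonoOn_of_deriv_pos (convex_Ici 0) hf.continuous.continuousOn ?_).monotoneOn
    intro x hx
    exact hf' x (interior_subset hx)
  have hτm : τ ∈ Set.Ioc 0 τ := ⟨hτ, le_rfl⟩
  have h1 := posSol_upd hτ (hGpos _ (hU1pos τ hτm)) hU1 hV1 hU1pos hV1pos hU1lim hV1lim
  have h2 := posSol_upd hτ (hGpos _ (hU2pos τ hτm)) hU2 hV2 hU2pos hV2pos hU2lim hV2lim
  have hne := hτ.ne'
  have key : ∀ t ∈ Set.Icc 0 τ,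
      Function.update U1 0 (G (U1 τ)) t = Function.update U2 0 (G (U2 τ)) t ∧
      Function.update V1 0 (V1 τ) t = Function.update V2 0 (V2 τ) t := by
    rcases le_total (Function.update U1 0 (G (U1 τ)) 0)
      (Function.update U2 0 (G (U2 τ)) 0) with h | h
    · exact uniq_aux ha11 ha12 ha22 hτ hf hm hfq hGq h1 h2 (by simp [hne]) (by simp [hne])
        (by simp [hne]) (by simp [hne]) h
    · intro t ht
      have := uniq_aux ha11 ha12 ha22 hτ hf hm hfq hGq h2 h1 (by simp [hne]) (by simp [hne])
        (by simp [hne]) (by simp [hne]) h t ht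
      exact ⟨this.1.symm, this.2.symm⟩
  constructor
  · intro t ht
    have := (key t (Set.Ioc_subset_Icc_self ht)).1
    rwa [Function.update_of_ne ht.1.ne', Function.update_of_ne ht.1.ne'] at this
  · intro t ht
    have := (key t (Set.Ioc_subset_Icc_self ht)).2
    rwa [Function.update_of_ne ht.1.ne', Function.update_of_ne ht.1.ne'] at this
end
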